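/- Let n ∈ ℕ, let c : Fin n → Fin n → Fin n → ℝ be skew-symmetric in its two lower indices, and let U : Matrix (Fin n) (Fin n) ℝ be orthogonal (Uᵀ * U = 1). Then R⁴(T_Λ(U)c) = T_S(U)(R⁴(c)), i.e. for all j, k: R⁴(T_Λ(U)c) j k = Σ_{p,q} U p j · U q k · R⁴(c) p q. -/

import Mathlib

open Matrix BigOperators

noncomputable section

/-- First piece of the Ricci tensor: `R¹(c) j k = -(1/2) Σ_{s,m} c s m j * c m s k`. -/
def R1 {n : ℕ} (c : Fin n → Fin n → Fin n → ℝ) (j k : Fin n) : ℝ :=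
  -(1/2) * ∑ s, ∑ m, c s m j * c m s k

/-- Second piece: `R²(c) j k = (1/2) Σ_{s,m} c m m s * (c k s j + c j s k)`. -/
def R2 {n : ℕ} (c : Fin n → Fin n → Fin n → ℝ) (j k : Fin n) : ℝ :=
  (1/2) * ∑ s, ∑ m, c m m s * (c k s j + c j s k)

/-- Third piece: `R³(c) j k = (1/4) Σ_{s,m} c j s m * c k s m`. -/
def R3 {n : ℕ} (c : Fin n → Fin n → Fin n → ℝ) (j k : Fin n) : ℝ :=
  (1/4) * ∑ s, ∑ m, c j s m * c k s m

/-- Fourth piece: `R⁴(c) j k = -(1/2) Σ_{s,m} c m s j * c m s k`. -/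
def R4 {n : ℕ} (c : Fin n → Fin n → Fin n → ℝ) (j k : Fin n) : ℝ :=
  -(1/2) * ∑ s, ∑ m, c m s j * c m s k

/-- The Ricci matrix `R(c) = R¹(c) + R²(c) + R³(c) + R⁴(c)`. -/
def Rtot {n : ℕ} (c : Fin n → Fin n → Fin n → ℝ) : Matrix (Fin n) (Fin n) ℝ :=
  Matrix.of fun j k => R1 c j k + R2 c j k + R3 c j k + R4 c j k

/-- The action of `GL(n)` on structure constants:
`(T_Λ(Q)c) k i j = Σ_{s,m,l} Q s i * Q m j * c l s m * (Q⁻¹) k l`. -/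
def TLam {n : ℕ} (Q : Matrix (Fin n) (Fin n) ℝ) (c : Fin n → Fin n → Fin n → ℝ) :
    Fin n → Fin n → Fin n → ℝ :=
  fun k i j => ∑ s, ∑ m, ∑ l, Q s i * Q m j * c l s m * Q⁻¹ k l

/-- The action of `GL(n)` on symmetric matrices:
`(T_S(Q)A) i j = Σ_{p,q} Q p i * Q q j * A p q`. -/
def TS {n : ℕ} (Q A : Matrix (Fin n) (Fin n) ℝ) : Matrix (Fin n) (Fin n) ℝ :=
  Matrix.of fun i j => ∑ p, ∑ q, Q p i * Q q j * A p q

/-- Entrywise derivative of a curve of matrices. -/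
def mderiv {n : ℕ} (Q : ℝ → Matrix (Fin n) (Fin n) ℝ) (t : ℝ) :
    Matrix (Fin n) (Fin n) ℝ :=
  Matrix.of fun i j => deriv (fun s => Q s i j) t

/-- The matrix `(c m s p)_{m,s}` of structure constants with the last lower index fixed. -/
def lastSlice {n : ℕ} (c : Fin n → Fin n → Fin n → ℝ) (p : Fin n) :
    Matrix (Fin n) (Fin n) ℝ :=
  Matrix.of fun m s => c m s p

theorem R4_eq_trace {n : ℕ} (c : Fin n → Fin n → Fin n → ℝ) (j k : Fin n) :
    R4 c j k = -(1/2) * ((lastSlice c j)ᵀ * lastSlice c k).trace := by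
  simp [R4, lastSlice, Matrix.trace, Matrix.mul_apply]

theorem lastSlice_TLam {n : ℕ} (Q : Matrix (Fin n) (Fin n) ℝ)
    (c : Fin n → Fin n → Fin n → ℝ) (j : Fin n) :
    lastSlice (TLam Q c) j = Q⁻¹ * (∑ p, Q p j • lastSlice c p) * Q := by
  ext m s
  simp only [lastSlice, TLam, Matrix.of_apply, Matrix.mul_apply, Matrix.sum_apply,
    Matrix.smul_apply, smul_eq_mul, Finset.sum_mul, Finset.mul_sum]
  refine Finset.sum_congr rfl fun a _ => ?_
  refine Finset.sum_congr rfl fun l _ => Finset.sum_congr rfl fun p _ => ?_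
  ring

/-- The trace form `tr(Aᵀ B)` is invariant under orthogonal conjugation. -/
theorem trace_transpose_mul_conj_orthogonal {n : ℕ} {U : Matrix (Fin n) (Fin n) ℝ}
    (hU : Uᵀ * U = 1) (A B : Matrix (Fin n) (Fin n) ℝ) :
    ((Uᵀ * A * U)ᵀ * (Uᵀ * B * U)).trace = (Aᵀ * B).trace := by
  have hU' : U * Uᵀ = 1 := mul_eq_one_comm.mp hU
  calc ((Uᵀ * A * U)ᵀ * (Uᵀ * B * U)).trace
      = (Uᵀ * (Aᵀ * (U * Uᵀ) * B * U)).trace := by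
        simp only [Matrix.transpose_mul, Matrix.transpose_transpose, Matrix.mul_assoc]
    _ = (Aᵀ * B).trace := by
        rw [Matrix.trace_mul_comm, hU', Matrix.mul_one, Matrix.mul_assoc, hU', Matrix.mul_one]

/-- `R⁴` is equivariant under the orthogonal group:
`R⁴(T_Λ(U)c) = T_S(U)(R⁴(c))` for any orthogonal `U`. -/
theorem R4_equivariant_O (n : ℕ) (c : Fin n → Fin n → Fin n → ℝ)
    (hc : ∀ i j k : Fin n, c k i j = - c k j i)
    (U : Matrix (Fin n) (Fin n) ℝ) (hU : Uᵀ * U = 1) (j k : Fin n) :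
    R4 (TLam U c) j k = ∑ p, ∑ q, U p j * U q k * R4 c p q := by
  have hinv : U⁻¹ = Uᵀ := Matrix.inv_eq_left_inv hU
  rw [R4_eq_trace, lastSlice_TLam, lastSlice_TLam, hinv, trace_transpose_mul_conj_orthogonal hU]
  simp only [R4_eq_trace, Matrix.transpose_sum, Matrix.transpose_smul, Matrix.sum_mul,
    Matrix.trace_sum, Matrix.smul_mul, Matrix.mul_smul, Matrix.trace_smul,
    smul_eq_mul, Finset.mul_sum]
  rw [Finset.sum_comm]
  refine Finset.sum_congr rfl fun p _ => Finset.sum_congr rfl fun q _ => ?_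
  ring
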